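/- arXiv:1704.04641 — 3 statements merged into one kernel-verified Lean document; each statement's English description precedes it below -/
import Mathlib

section
/- Define R₃₁ = (1/2)·log(1 + p₃₁/(2p₁₀ + 2p₃₀ + p₁₁ + σ)), R₃₀ = (1/2)·[log(1/2 + p₃₀/(2p₁₀ + p₁₁ + σ))]⁺, R₁₁ = (1/2)·log(1 + p₁₁/(2p₁₀ + σ)), and R₁₀ = (1/2)·[log(1/2 + p₁₀/σ)]⁺. Then R₁₀ + R₁₁ ≥ C₁ − 1/2, R₁₀ ≥ C₂ − 1/2, R₃₀ + R₃₁ ≥ (C₁₃ − C₁) − 1/2, and R₃₀ ≥ (C₁₄ − C₁) − 1/2. -/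
/-- `log₂ (1 + x / y)` as a difference of logarithms. -/
lemma logb_two_one_add_div {x y : ℝ} (hy : 0 < y) (hxy : 0 < y + x) :
    Real.logb 2 (1 + x / y) = Real.logb 2 (y + x) - Real.logb 2 y := by
  rw [← Real.logb_div hxy.ne' hy.ne', add_div, div_self hy.ne']

/-- Halving both terms inside `log₂ (1 + x / y)` costs exactly one bit. -/
lemma logb_two_half_add_half_div {x y : ℝ} (hy : 0 < y) (hxy : 0 < y + x) :
    Real.logb 2 (1 / 2 + x / 2 / y) = Real.logb 2 (y + x) - Real.logb 2 y - 1 := by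
  have h : 1 / 2 + x / 2 / y = (y + x) / y / 2 := by
    field_simp
  rw [h, Real.logb_div (div_pos hxy hy).ne' two_ne_zero, Real.logb_div hxy.ne' hy.ne',
    Real.logb_self_eq_one one_lt_two]

theorem stmt5 (a1 a2 a3 a4 σ p10 p30 p11 p31 C1 C2 C3 C4 C13 C14 C23 C24 R10 R11 R30 R31 : ℝ)
    (ha1 : 0 < a1) (ha2 : 0 < a2) (ha3 : 0 < a3) (ha4 : 0 < a4) (hσ : 0 < σ)
    (h12 : a2 ≤ a1) (h34 : a4 ≤ a3)
    (hC1 : C1 = 1/2 * Real.logb 2 (1 + a1/σ))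
    (hC2 : C2 = 1/2 * Real.logb 2 (1 + a2/σ))
    (hC3 : C3 = 1/2 * Real.logb 2 (1 + a3/σ))
    (hC4 : C4 = 1/2 * Real.logb 2 (1 + a4/σ))
    (hC13 : C13 = 1/2 * Real.logb 2 (1 + (a1 + a3)/σ))
    (hC14 : C14 = 1/2 * Real.logb 2 (1 + (a1 + a4)/σ))
    (hC23 : C23 = 1/2 * Real.logb 2 (1 + (a2 + a3)/σ))
    (hC24 : C24 = 1/2 * Real.logb 2 (1 + (a2 + a4)/σ))
    (hp10 : p10 = a2/2) (hp30 : p30 = a4/2)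
    (hp11 : p11 = a1 - a2) (hp31 : p31 = a3 - a4)
    (hR31 : R31 = 1/2 * Real.logb 2 (1 + p31/(2*p10 + 2*p30 + p11 + σ)))
    (hR30 : R30 = 1/2 * max (Real.logb 2 (1/2 + p30/(2*p10 + p11 + σ))) 0)
    (hR11 : R11 = 1/2 * Real.logb 2 (1 + p11/(2*p10 + σ)))
    (hR10 : R10 = 1/2 * max (Real.logb 2 (1/2 + p10/σ)) 0) :
    R10 + R11 ≥ C1 - 1/2 ∧ R10 ≥ C2 - 1/2 ∧
    R30 + R31 ≥ (C13 - C1) - 1/2 ∧ R30 ≥ (C14 - C1) - 1/2 := by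
  have e1 : 2 * p10 + p11 + σ = σ + a1 := by rw [hp10, hp11]; ring
  have e2 : 2 * p10 + 2 * p30 + p11 + σ = σ + (a1 + a4) := by rw [hp10, hp30, hp11]; ring
  have e3 : 2 * p10 + σ = σ + a2 := by rw [hp10]; ring
  have s1 : σ + a2 + (a1 - a2) = σ + a1 := by ring
  have s2 : σ + (a1 + a4) + (a3 - a4) = σ + (a1 + a3) := by ring
  rw [logb_two_one_add_div hσ (by positivity)] at hC1 hC2 hC13 hC14
  rw [e2, hp31, logb_two_one_add_div (by positivity) (by rw [s2]; positivity), s2] at hR31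
  rw [e1, hp30, logb_two_half_add_half_div (by positivity) (by positivity), add_assoc] at hR30
  rw [e3, hp11, logb_two_one_add_div (by positivity) (by rw [s1]; positivity), s1] at hR11
  rw [hp10, logb_two_half_add_half_div hσ (by positivity)] at hR10
  have m10 := le_max_left (Real.logb 2 (σ + a2) - Real.logb 2 σ - 1) 0
  have m30 := le_max_left (Real.logb 2 (σ + (a1 + a4)) - Real.logb 2 (σ + a1) - 1) 0
  refine ⟨?_, ?_, ?_, ?_⟩ <;> linarith
end

section
/- Define R₁₁ = (1/2)·log(1 + p₁₁/(2p₁₀ + 2p₃₀ + p₃₁ + σ)), R₃₁ = (1/2)·log(1 + p₃₁/(2p₁₀ + 2p₃₀ + σ)), R₃₀ = (1/2)·[log(1/2 + p₃₀/(2p₁₀ + σ))]⁺, and R₁₀ = (1/2)·[log(1/2 + p₁₀/σ)]⁺. Then R₁₀ + R₁₁ ≥ (C₁₃ − C₂₃ + C₂) − 1/2, R₁₀ ≥ C₂ − 1/2, R₃₀ + R₃₁ ≥ (C₂₃ − C₂) − 1/2, and R₃₀ ≥ (C₂₄ − C₂) − 1/2. -/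
theorem logb_one_add_div {b x y : ℝ} (hy : 0 < y) (hx : 0 ≤ x) :
    Real.logb b (1 + x / y) = Real.logb b (y + x) - Real.logb b y := by
  rw [one_add_div hy.ne', Real.logb_div (by positivity) hy.ne']

theorem logb_half_add_half_div {x y : ℝ} (hy : 0 < y) (hx : 0 ≤ x) :
    Real.logb 2 (1 / 2 + x / 2 / y) = Real.logb 2 (y + x) - Real.logb 2 y - 1 := by
  have h : 1 / 2 + x / 2 / y = (1 + x / y) / 2 := by ring
  rw [h, Real.logb_div (by positivity) two_ne_zero, logb_one_add_div hy hx,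
    Real.logb_self_eq_one one_lt_two]

theorem stmt8 (a1 a2 a3 a4 σ p10 p30 p11 p31 C1 C2 C3 C4 C13 C14 C23 C24 R10 R11 R30 R31 : ℝ)
    (ha1 : 0 < a1) (ha2 : 0 < a2) (ha3 : 0 < a3) (ha4 : 0 < a4) (hσ : 0 < σ)
    (h12 : a2 ≤ a1) (h34 : a4 ≤ a3)
    (hC1 : C1 = 1/2 * Real.logb 2 (1 + a1/σ))
    (hC2 : C2 = 1/2 * Real.logb 2 (1 + a2/σ))
    (hC3 : C3 = 1/2 * Real.logb 2 (1 + a3/σ))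
    (hC4 : C4 = 1/2 * Real.logb 2 (1 + a4/σ))
    (hC13 : C13 = 1/2 * Real.logb 2 (1 + (a1 + a3)/σ))
    (hC14 : C14 = 1/2 * Real.logb 2 (1 + (a1 + a4)/σ))
    (hC23 : C23 = 1/2 * Real.logb 2 (1 + (a2 + a3)/σ))
    (hC24 : C24 = 1/2 * Real.logb 2 (1 + (a2 + a4)/σ))
    (hp10 : p10 = a2/2) (hp30 : p30 = a4/2)
    (hp11 : p11 = a1 - a2) (hp31 : p31 = a3 - a4)
    (hR11 : R11 = 1/2 * Real.logb 2 (1 + p11/(2*p10 + 2*p30 + p31 + σ)))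
    (hR31 : R31 = 1/2 * Real.logb 2 (1 + p31/(2*p10 + 2*p30 + σ)))
    (hR30 : R30 = 1/2 * max (Real.logb 2 (1/2 + p30/(2*p10 + σ))) 0)
    (hR10 : R10 = 1/2 * max (Real.logb 2 (1/2 + p10/σ)) 0) :
    R10 + R11 ≥ (C13 - C23 + C2) - 1/2 ∧ R10 ≥ C2 - 1/2 ∧
    R30 + R31 ≥ (C23 - C2) - 1/2 ∧ R30 ≥ (C24 - C2) - 1/2 := by
  subst hp10 hp30 hp11 hp31
  have e2 : C2 = 1/2 * (Real.logb 2 (a2 + σ) - Real.logb 2 σ) := by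
    rw [hC2, logb_one_add_div hσ ha2.le, add_comm σ]
  have e13 : C13 = 1/2 * (Real.logb 2 (a1 + a3 + σ) - Real.logb 2 σ) := by
    rw [hC13, logb_one_add_div hσ (by positivity), add_comm σ]
  have e23 : C23 = 1/2 * (Real.logb 2 (a2 + a3 + σ) - Real.logb 2 σ) := by
    rw [hC23, logb_one_add_div hσ (by positivity), add_comm σ]
  have e24 : C24 = 1/2 * (Real.logb 2 (a2 + a4 + σ) - Real.logb 2 σ) := by
    rw [hC24, logb_one_add_div hσ (by positivity), add_comm σ]
  have hR11' : R11 = C13 - C23 := by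
    rw [hR11, logb_one_add_div (by linarith) (by linarith), e13, e23]
    ring_nf
  have hR31' : R31 = C23 - C24 := by
    rw [hR31, logb_one_add_div (by linarith) (by linarith), e23, e24]
    ring_nf
  have hR10' : C2 - 1/2 ≤ R10 := by
    have h := le_max_left (Real.logb 2 (1/2 + a2/2/σ)) 0
    rw [logb_half_add_half_div hσ ha2.le, add_comm σ] at h
    rw [logb_half_add_half_div hσ ha2.le, add_comm σ] at hR10
    linarith
  have hR30' : C24 - C2 - 1/2 ≤ R30 := by
    have hpos : 0 < a2 + σ := by positivity
    rw [mul_div_cancel₀ a2 two_ne_zero, logb_half_add_half_div hpos ha4.le,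
      add_right_comm a2 σ a4] at hR30
    have h := le_max_left
      (Real.logb 2 (a2 + a4 + σ) - Real.logb 2 (a2 + σ) - 1) 0
    linarith
  refine ⟨?_, ?_, ?_, ?_⟩ <;> linarith
end

section
/- Suppose b₃ ≥ b₄ ≥ b₁ ≥ b₂ > 0. Set q₂ = min(P, b₃) and q₁ = P − q₂. Then (1/2)·log(1 + q₂/b₂) + 1/2 ≥ D₂ − D₃, (1/2)·log(1 + q₂/b₁) + 1/2 ≥ D₁ − D₃, (1/2)·log(1 + q₁/(q₂ + b₄)) + 1/2 ≥ D₃, and (1/2)·log(1 + q₁/(q₂ + b₃)) + 1/2 ≥ D₃. -/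
theorem half_logb_two_le_add_half {x y : ℝ} (hx : 0 < x) (hy : 0 < y) (h : x ≤ 2 * y) :
    1/2 * Real.logb 2 x ≤ 1/2 * Real.logb 2 y + 1/2 := by
  have hlog := Real.logb_le_logb_of_le one_lt_two hx h
  rw [Real.logb_mul two_ne_zero hy.ne', Real.logb_self_eq_one one_lt_two] at hlog
  linarith

theorem half_logb_sub_le_of_power_min {b c P : ℝ} (hb : 0 < b) (hc : 0 < c) (hP : 0 < P) :
    1/2 * Real.logb 2 (1 + P/b) - 1/2 * Real.logb 2 (1 + P/c) ≤
      1/2 * Real.logb 2 (1 + min P c/b) + 1/2 := by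
  have hm : 0 < min P c := lt_min hP hc
  have hy : 0 < 1 + min P c/b := by positivity
  have hz : 0 < 1 + P/c := by positivity
  have key : 1 + P/b ≤ 2 * ((1 + min P c/b) * (1 + P/c)) := by
    have hx : 1 + P/b = (b + P) * c / (b * c) := by field_simp
    have hyz : 2 * ((1 + min P c/b) * (1 + P/c)) =
        2 * (b + min P c) * (c + P) / (b * c) := by field_simp
    rw [hx, hyz]
    gcongr ?_ / _
    rcases min_cases P c with ⟨h, _⟩ | ⟨h, _⟩ <;> rw [h] <;>
      nlinarith [mul_pos hb hc, mul_pos hb hP, mul_pos hP hc, mul_pos hP hP, mul_pos hc hc]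
  have h := half_logb_two_le_add_half (by positivity) (mul_pos hy hz) key
  rw [Real.logb_mul hy.ne' hz.ne'] at h
  linarith

theorem half_logb_le_of_power_sub_min {b c P : ℝ} (hb : 0 < b) (hbc : b ≤ c) (hP : 0 < P) :
    1/2 * Real.logb 2 (1 + P/c) ≤
      1/2 * Real.logb 2 (1 + (P - min P c)/(min P c + b)) + 1/2 := by
  have hc : 0 < c := hb.trans_le hbc
  have hm : 0 < min P c := lt_min hP hc
  have hr : 0 ≤ P - min P c := sub_nonneg.2 (min_le_left P c)
  refine half_logb_two_le_add_half (by positivity) (by positivity) ?_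
  rcases le_total P c with h | h
  · have : P / c ≤ 1 := (div_le_one hc).2 h
    rw [min_eq_left h, sub_self, zero_div]
    linarith
  · rw [min_eq_right h]
    have hx : 1 + P/c = (c + P) / c := by field_simp
    have hy : 2 * (1 + (P - c)/(c + b)) = 2 * (P + b) / (c + b) := by
      field_simp
      ring
    rw [hx, hy, div_le_div_iff₀ hc (by positivity)]
    nlinarith [mul_nonneg (sub_nonneg.2 h) (sub_nonneg.2 hbc)]

theorem stmt11 (b1 b2 b3 b4 P q1 q2 D1 D2 D3 D4 : ℝ)
    (hb2 : 0 < b2) (h21 : b2 ≤ b1) (h14 : b1 ≤ b4) (h43 : b4 ≤ b3) (hP : 0 < P)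
    (hD1 : D1 = 1/2 * Real.logb 2 (1 + P/b1))
    (hD2 : D2 = 1/2 * Real.logb 2 (1 + P/b2))
    (hD3 : D3 = 1/2 * Real.logb 2 (1 + P/b3))
    (hD4 : D4 = 1/2 * Real.logb 2 (1 + P/b4))
    (hq2 : q2 = min P b3) (hq1 : q1 = P - q2) :
    1/2 * Real.logb 2 (1 + q2/b2) + 1/2 ≥ D2 - D3 ∧
    1/2 * Real.logb 2 (1 + q2/b1) + 1/2 ≥ D1 - D3 ∧
    1/2 * Real.logb 2 (1 + q1/(q2 + b4)) + 1/2 ≥ D3 ∧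
    1/2 * Real.logb 2 (1 + q1/(q2 + b3)) + 1/2 ≥ D3 := by
  have hb1 : 0 < b1 := hb2.trans_le h21
  have hb4 : 0 < b4 := hb1.trans_le h14
  have hb3 : 0 < b3 := hb4.trans_le h43
  subst hq1 hq2 hD1 hD2 hD3
  exact ⟨half_logb_sub_le_of_power_min hb2 hb3 hP, half_logb_sub_le_of_power_min hb1 hb3 hP,
    half_logb_le_of_power_sub_min hb4 h43 hP, half_logb_le_of_power_sub_min hb3 le_rfl hP⟩
end
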